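/- Let Q : ℤ → ℤ → ℝ be a Q-matrix (Q n m ≥ 0 for m ≠ n, each family (Q n m)_{m ≠ n} summable, Q n n = −∑_{m ≠ n} Q n m), set ω n m = Q n (n+m), and assume ω n i = 0 for all n ∈ ℤ and all i > 0 (no jumps to the right). Define the dual rates ω̃ n i = ∑_{l = −i}^{∞} (ω (n+i) l − ω (n+i−1) (l+1)). Then ω̃ n (−i) = 0 for all i > 0, and for every i > 0: ω̃ n i = ω (n+i−1) (−i) + ∑_{l = i+1}^{∞} (ω (n+i−1) (−l) − ω (n+i) (−l)). -/

import Mathlib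

/-- The total mass of a row of a Q-matrix is zero. -/
lemma hasSum_row_zero {q : ℤ → ℝ} {n : ℤ}
    (hsum : Summable (fun m : {m : ℤ // m ≠ n} => q m.1))
    (hdiag : q n = -∑' m : {m : ℤ // m ≠ n}, q m.1) : HasSum q 0 := by
  have h1 : HasSum (q ∘ (↑) : ({n} : Set ℤ) → ℝ) (q n) := by
    simpa using hasSum_unique (q ∘ (↑) : ({n} : Set ℤ) → ℝ)
  have h2 : HasSum (q ∘ (↑) : (({n} : Set ℤ)ᶜ : Set ℤ) → ℝ)
      (∑' m : {m : ℤ // m ≠ n}, q m.1) := hsum.hasSum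
  have h := h1.add_compl h2
  rwa [hdiag, neg_add_cancel] at h

/-- If a family on `ℤ` sums to zero, its upper tail is minus its lower tail. -/
lemma tsum_upper_eq_neg_lower {f : ℤ → ℝ} (hf : HasSum f 0) (k : ℤ) :
    ∑' l : {l : ℤ // -k ≤ l}, f l.1 = -∑' l : {l : ℤ // k + 1 ≤ l}, f (-l.1) := by
  have h := hf.summable.tsum_subtype_add_tsum_subtype_compl (Set.Ici (-k))
  rw [hf.tsum_eq] at h
  let e : {l : ℤ // k + 1 ≤ l} ≃ ((Set.Ici (-k))ᶜ : Set ℤ) :=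
    (Equiv.neg ℤ).subtypeEquiv fun a => by
      simp only [Set.mem_compl_iff, Set.mem_Ici, Equiv.neg_apply]
      omega
  have he : ∑' l : {l : ℤ // k + 1 ≤ l}, f (-l.1)
      = ∑' l : ((Set.Ici (-k))ᶜ : Set ℤ), f l.1 :=
    e.tsum_eq (fun l : ((Set.Ici (-k))ᶜ : Set ℤ) => f l.1)
  rw [he]
  exact eq_neg_of_add_eq_zero_left h

/-- Shifting an upper tail by one and splitting off its first term. -/
lemma tsum_tail_sub_one {f : ℤ → ℝ} (hf : Summable f) (k : ℤ) :
    ∑' l : {l : ℤ // k + 1 ≤ l}, f (l.1 - 1)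
      = f k + ∑' l : {l : ℤ // k + 1 ≤ l}, f l.1 := by
  let e : {l : ℤ // k + 1 ≤ l} ≃ {l : ℤ // k ≤ l} :=
    (Equiv.subRight (1 : ℤ)).subtypeEquiv fun a => by
      simp only [Equiv.subRight_apply]
      omega
  have he : ∑' l : {l : ℤ // k + 1 ≤ l}, f (l.1 - 1) = ∑' l : {l : ℤ // k ≤ l}, f l.1 :=
    e.tsum_eq (fun l : {l : ℤ // k ≤ l} => f l.1)
  have hunion : Set.Ici k = {k} ∪ Set.Ici (k + 1) := by
    ext l
    simp only [Set.mem_Ici, Set.mem_union, Set.mem_singleton_iff]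
    omega
  have hdisj : Disjoint ({k} : Set ℤ) (Set.Ici (k + 1)) := by simp
  have h : ∑' l : Set.Ici k, f l.1 = f k + ∑' l : Set.Ici (k + 1), f l.1 := by
    rw [hunion, Summable.tsum_union_disjoint hdisj (hf.subtype _) (hf.subtype _),
      tsum_singleton]
  exact he.trans h


/-- For a Q-matrix with no jumps to the right, the dual rates have no
jumps to the left, and for `i > 0`,
`ω̃ n i = ω (n+i−1) (−i) + ∑_{l=i+1}^∞ (ω (n+i−1) (−l) − ω (n+i) (−l))`. -/
theorem dual_rates_left_jumps_become_right
    (Q : ℤ → ℤ → ℝ)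
    (hpos : ∀ n m : ℤ, m ≠ n → 0 ≤ Q n m)
    (hsum : ∀ n : ℤ, Summable (fun m : {m : ℤ // m ≠ n} => Q n m.1))
    (hdiag : ∀ n : ℤ, Q n n = -∑' m : {m : ℤ // m ≠ n}, Q n m.1)
    (ω : ℤ → ℤ → ℝ) (hω : ∀ n m : ℤ, ω n m = Q n (n + m))
    (hright : ∀ n i : ℤ, 0 < i → ω n i = 0)
    (ωd : ℤ → ℤ → ℝ)
    (hωd : ∀ n i : ℤ,
      ωd n i = ∑' l : {l : ℤ // -i ≤ l}, (ω (n + i) l.1 - ω (n + i - 1) (l.1 + 1))) :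
    (∀ n i : ℤ, 0 < i → ωd n (-i) = 0)
    ∧ (∀ n i : ℤ, 0 < i →
        ωd n i = ω (n + i - 1) (-i)
          + ∑' l : {l : ℤ // i + 1 ≤ l}, (ω (n + i - 1) (-l.1) - ω (n + i) (-l.1))) := by
  have hrow : ∀ n, HasSum (ω n) 0 := fun n => by
    rw [show ω n = Q n ∘ Equiv.addLeft n from funext (hω n)]
    exact (Equiv.hasSum_iff _).2 (hasSum_row_zero (hsum n) (hdiag n))
  refine ⟨fun n i hi => ?_, fun n i _ => ?_⟩
  · rw [hωd]
    refine (tsum_congr fun l => ?_).trans tsum_zero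
    have hl := l.2
    rw [hright _ _ (by omega), hright _ _ (by omega), sub_zero]
  · rw [hωd]
    set a := ω (n + i)
    set b := ω (n + i - 1)
    have ha : HasSum a 0 := hrow _
    have hb : HasSum b 0 := hrow _
    have hb' : HasSum (fun l => b (l + 1)) 0 := (Equiv.hasSum_iff (Equiv.addRight (1 : ℤ))).2 hb
    have hbn : Summable fun l => b (-l) := (Equiv.summable_iff (Equiv.neg ℤ)).2 hb.summable
    have han : Summable fun l => a (-l) := (Equiv.summable_iff (Equiv.neg ℤ)).2 ha.summable
    have hsplit : ∑' l : {l : ℤ // -i ≤ l}, (a l.1 - b (l.1 + 1))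
        = ∑' l : {l : ℤ // -i ≤ l}, a l.1 - ∑' l : {l : ℤ // -i ≤ l}, b (l.1 + 1) :=
      (ha.summable.subtype (Set.Ici (-i))).tsum_sub (hb'.summable.subtype (Set.Ici (-i)))
    have hsplit' : ∑' l : {l : ℤ // i + 1 ≤ l}, (b (-l.1) - a (-l.1))
        = ∑' l : {l : ℤ // i + 1 ≤ l}, b (-l.1) - ∑' l : {l : ℤ // i + 1 ≤ l}, a (-l.1) :=
      (hbn.subtype (Set.Ici (i + 1))).tsum_sub (han.subtype (Set.Ici (i + 1)))
    have hta := tsum_upper_eq_neg_lower ha i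
    have htb := tsum_upper_eq_neg_lower hb' i
    have hshift := tsum_tail_sub_one hbn i
    simp only [neg_sub', sub_neg_eq_add] at hshift
    rw [hsplit, hsplit', hta, htb, hshift]
    ring
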